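/- Let m ≥ 1 and let w ∈ ℤ with w ≥ 3. Let d_1,…,d_m ∈ ℤ with d_1 = −1 and 0 ≤ d_i ≤ w−3 for i = 2,…,m. Let g = (g_{kl}) be a symmetric invertible complex m×m matrix with g_{kl} = 0 whenever d_k + d_l ≠ w − 4. For r = 1, 2 let A_1^{(r)},…,A_m^{(r)} : N_r → M_m(ℂ) be holomorphic maps on connected open neighborhoods N_r of 0 in ℂ^m (coordinates t_1,…,t_m), with entries written A_i^{(r)} = (a_{ij}^{k,(r)})_{k,j}, and suppose each of the two tuples satisfies, for all i, j, k, l ∈ {1,…,m}: (1) A_i A_j = A_j A_i; (2) a_{i1}^{k} = δ_{ik}; (3) a_{ij}^{k} = a_{ji}^{k}; (4) ∂A_i/∂t_j = ∂A_j/∂t_i; (5) Σ_{s=1}^m d_s t_s ∂a_{ij}^{k}/∂t_s = (d_k − d_i − d_j − 1)·a_{ij}^{k}; (6) Σ_{s} a_{ij}^{s} g_{sl} = Σ_{s} a_{il}^{s} g_{sj}. Assume moreover the generation condition (II)': in the commutative associative algebra on ℂ^m with unit e_1 and product e_i ∘ e_j := Σ_k a_{ij}^{k,(1)}(0) e_k,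 the subalgebra generated by { e_i : d_i = 0 } contains every e_k with d_k < (w−4)/2. If A_i^{(1)} = A_i^{(2)} on N_1 ∩ N_2 ∩ { t ∈ ℂ^m : t_s = 0 for every s with d_s ≠ 0 } for every i with d_i = 0, then A_i^{(1)} = A_i^{(2)} on a neighborhood of 0 in ℂ^m for every i = 1,…,m. -/

import Mathlib

/-!
Statement 13 (Lemma 8.2, flat-coordinate form): a germ of a Frobenius manifold
with the weakened H²-generation condition (II)' is uniquely determined by the
restriction of its data to the zero locus of the Euler field.
-/

noncomputable section

/-- `m × m` complex matrices. -/
abbrev Mat (m : ℕ) := Matrix (Fin m) (Fin m) ℂ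

/-- Entrywise holomorphy of a matrix-valued map on a set. -/
def MDiffOn {E : Type*} [NormedAddCommGroup E] [NormedSpace ℂ E] {m : ℕ}
    (f : E → Mat m) (s : Set E) : Prop :=
  ∀ k j, DifferentiableOn ℂ (fun q => f q k j) s

/-- Entrywise partial derivative of a matrix-valued map at `p` in direction `v`. -/
def mpderiv {E : Type*} [NormedAddCommGroup E] [NormedSpace ℂ E] {m : ℕ}
    (f : E → Mat m) (p v : E) : Mat m :=
  Matrix.of fun k j => fderiv ℂ (fun q => f q k j) p v

/-- Conditions (1)–(6) on the multiplication matrices `A_i = (a_{ij}^k)_{k,j}`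
of a Frobenius manifold in flat coordinates, on the set `N`. -/
def FrobSystem (m : ℕ) (hm : 0 < m) (w : ℤ) (d : Fin m → ℤ)
    (g : Mat m) (N : Set (Fin m → ℂ))
    (A : Fin m → (Fin m → ℂ) → Mat m) : Prop :=
  ∀ t ∈ N,
    -- (1) commutativity
    (∀ i j, A i t * A j t = A j t * A i t) ∧
    -- (2) unit: a_{i1}^k = δ_{ik}
    (∀ i k, A i t k (⟨0, hm⟩ : Fin m) = if i = k then 1 else 0) ∧
    -- (3) symmetry a_{ij}^k = a_{ji}^k
    (∀ i j k, A i t k j = A j t k i) ∧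
    -- (4) potentiality ∂A_i/∂t_j = ∂A_j/∂t_i
    (∀ i j, mpderiv (A i) t (Pi.single j 1) = mpderiv (A j) t (Pi.single i 1)) ∧
    -- (5) Euler homogeneity
    (∀ i j k, ∑ s, (d s : ℂ) * t s * mpderiv (A i) t (Pi.single s 1) k j =
      ((d k - d i - d j - 1 : ℤ) : ℂ) * A i t k j) ∧
    -- (6) multiplication invariance of the metric
    (∀ i j k, ∑ s, A i t s j * g s k = ∑ s, A i t s k * g s j)

open Filter Topology Asymptotics Metric

/-- The components of `t` in the directions of nonzero weight. -/
def transversal {m : ℕ} (d : Fin m → ℤ) (t : Fin m → ℂ) : Fin m → ℂ :=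
  fun s => if d s = 0 then 0 else t s

/-- `f` vanishes to order `n` at `0` along the zero locus of the Euler field. -/
def VanishesToOrder {m : ℕ} (d : Fin m → ℤ) (n : ℕ) (f : (Fin m → ℂ) → ℂ) : Prop :=
  f =O[𝓝 0] fun t => ‖transversal d t‖ ^ n

lemma norm_transversal_le {m : ℕ} (d : Fin m → ℤ) (t : Fin m → ℂ) :
    ‖transversal d t‖ ≤ ‖t‖ := by
  refine (pi_norm_le_iff_of_nonneg (norm_nonneg t)).2 fun s => ?_
  by_cases h : d s = 0
  · simp [transversal, h]
  · simpa [transversal, h] using norm_le_pi_norm t s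

lemma VanishesToOrder.add {m : ℕ} {d : Fin m → ℤ} {n : ℕ} {f h : (Fin m → ℂ) → ℂ}
    (hf : VanishesToOrder d n f) (hh : VanishesToOrder d n h) :
    VanishesToOrder d n fun t => f t + h t :=
  IsBigO.add hf hh

lemma VanishesToOrder.sum {m : ℕ} {d : Fin m → ℤ} {n : ℕ} {ι : Type*} {u : Finset ι}
    {f : ι → (Fin m → ℂ) → ℂ} (hf : ∀ i ∈ u, VanishesToOrder d n (f i)) :
    VanishesToOrder d n fun t => ∑ i ∈ u, f i t :=
  IsBigO.fun_sum hf

lemma VanishesToOrder.mul {m : ℕ} {d : Fin m → ℤ} {a b : ℕ} {f h : (Fin m → ℂ) → ℂ}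
    (hf : VanishesToOrder d a f) (hh : VanishesToOrder d b h) :
    VanishesToOrder d (a + b) fun t => f t * h t := by
  simpa only [VanishesToOrder, pow_add] using IsBigO.mul hf hh

lemma VanishesToOrder.congr {m : ℕ} {d : Fin m → ℤ} {n : ℕ} {f h : (Fin m → ℂ) → ℂ}
    (hf : VanishesToOrder d n f) (e : f =ᶠ[𝓝 0] h) : VanishesToOrder d n h :=
  IsBigO.congr' hf e EventuallyEq.rfl

lemma ContinuousAt.vanishesToOrder_zero {m : ℕ} {d : Fin m → ℤ} {f : (Fin m → ℂ) → ℂ}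
    (hf : ContinuousAt f 0) : VanishesToOrder d 0 f := by
  simpa only [VanishesToOrder, pow_zero] using hf.tendsto.isBigO_one ℝ

lemma vanishesToOrder_zero_fun {m : ℕ} (d : Fin m → ℤ) (n : ℕ) :
    VanishesToOrder d n fun _ => 0 :=
  isBigO_zero _ _

/-- Cauchy's estimate: a bound that is invariant under translation along `v` passes to the
derivative along `v`. -/
lemma isBigO_fderiv_of_translation_invariant {E : Type*} [NormedAddCommGroup E]
    [NormedSpace ℂ E] {f : E → ℂ} {r : ℝ} (hr : 0 < r)
    (hf : DifferentiableOn ℂ f (ball 0 r)) {ρ : E → ℝ} (hfρ : f =O[𝓝 0] ρ) {v : E}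
    (hρ : ∀ t (z : ℂ), ρ (t + z • v) = ρ t) :
    (fun t => fderiv ℂ f t v) =O[𝓝 0] ρ := by
  obtain ⟨C, hC⟩ := hfρ.bound
  obtain ⟨ε, hε, hball⟩ := Metric.eventually_nhds_iff_ball.1
    (hC.and (Metric.ball_mem_nhds (0 : E) hr))
  set R : ℝ := ε / (2 * (‖v‖ + 1)) with hR
  have hv : 0 < ‖v‖ + 1 := by positivity
  have hRpos : 0 < R := by positivity
  have hRv : R * ‖v‖ < ε / 2 := by
    have h1 : R * (‖v‖ + 1) = ε / 2 := by rw [hR]; field_simp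
    nlinarith
  refine IsBigO.of_bound (C / R) ?_
  filter_upwards [Metric.ball_mem_nhds (0 : E) (half_pos hε)] with t ht
  have hmem : ∀ z : ℂ, ‖z‖ ≤ R → t + z • v ∈ ball (0 : E) ε := by
    intro z hz
    rw [mem_ball_zero_iff] at ht ⊢
    have h1 : ‖z • v‖ ≤ R * ‖v‖ := by
      rw [norm_smul]; gcongr
    linarith [norm_add_le t (z • v)]
  have hd : ∀ z : ℂ, ‖z‖ ≤ R → HasDerivAt (fun z : ℂ => f (t + z • v))
      (fderiv ℂ f (t + z • v) v) z := by
    intro z hz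
    have h1 : HasFDerivAt f (fderiv ℂ f (t + z • v)) (t + z • v) :=
      (hf.differentiableAt (isOpen_ball.mem_nhds (hball _ (hmem z hz)).2)).hasFDerivAt
    have h2 : HasDerivAt (fun z : ℂ => t + z • v) v z := by
      simpa using ((hasDerivAt_id z).smul_const v).const_add t
    exact h1.comp_hasDerivAt z h2
  have hdc : DiffContOnCl ℂ (fun z : ℂ => f (t + z • v)) (ball 0 R) := by
    apply DifferentiableOn.diffContOnCl
    intro z hz
    have := closure_ball_subset_closedBall hz
    exact (hd z (mem_closedBall_zero_iff.1 this)).differentiableAt.differentiableWithinAt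
  have key := Complex.norm_deriv_le_of_forall_mem_sphere_norm_le hRpos hdc
    (C := C * ‖ρ t‖) (fun z hz => by
      have h1 := (hball _ (hmem z (mem_sphere_zero_iff_norm.1 hz).le)).1
      rwa [hρ] at h1)
  rw [(hd 0 (by simpa using hRpos.le)).deriv] at key
  simp only [zero_smul, add_zero] at key
  calc _ ≤ _ := key
    _ = _ := by ring

lemma VanishesToOrder.fderiv_tangential {m : ℕ} {d : Fin m → ℤ} {n : ℕ} {r : ℝ} (hr : 0 < r)
    {f : (Fin m → ℂ) → ℂ} (hf : DifferentiableOn ℂ f (ball 0 r))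
    (hv : VanishesToOrder d n f) {i : Fin m} (hi : d i = 0) :
    VanishesToOrder d n fun t => fderiv ℂ f t (Pi.single i 1) := by
  refine isBigO_fderiv_of_translation_invariant hr hf hv fun t z => ?_
  congr 2
  ext s
  by_cases hs : d s = 0
  · simp [transversal, hs]
  · have : s ≠ i := by rintro rfl; exact hs hi
    simp [transversal, hs, this]

lemma vanishesToOrder_zero_fderiv {m : ℕ} {d : Fin m → ℤ} {r : ℝ} (hr : 0 < r)
    {f : (Fin m → ℂ) → ℂ} (hf : DifferentiableOn ℂ f (ball 0 r)) (v : Fin m → ℂ) :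
    VanishesToOrder d 0 fun t => fderiv ℂ f t v := by
  have h0 : VanishesToOrder d 0 f := ContinuousAt.vanishesToOrder_zero
    (hf.differentiableAt (ball_mem_nhds _ hr)).continuousAt
  simp only [VanishesToOrder, pow_zero] at h0 ⊢
  exact isBigO_fderiv_of_translation_invariant hr hf h0 fun _ _ => rfl

lemma fderiv_apply_eq_sum {m : ℕ} (f : (Fin m → ℂ) → ℂ) (t v : Fin m → ℂ) :
    fderiv ℂ f t v = ∑ s, v s * fderiv ℂ f t (Pi.single s 1) := by
  conv_lhs => rw [pi_eq_sum_univ' v]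
  simp [map_sum]

/-- A function vanishing on the zero locus of the Euler field gains one order over its
transversal derivatives. -/
lemma VanishesToOrder.of_fderiv {m : ℕ} {d : Fin m → ℤ} {n : ℕ} {r : ℝ} (hr : 0 < r)
    {f : (Fin m → ℂ) → ℂ} (hf : DifferentiableOn ℂ f (ball 0 r))
    (hzero : ∀ t ∈ ball (0 : Fin m → ℂ) r, (∀ s, d s ≠ 0 → t s = 0) → f t = 0)
    (hder : ∀ s, d s ≠ 0 → VanishesToOrder d n fun t => fderiv ℂ f t (Pi.single s 1)) :
    VanishesToOrder d (n + 1) f := by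
  have hsum : (fun t => ∑ s with d s ≠ 0, ‖fderiv ℂ f t (Pi.single s 1)‖) =O[𝓝 0]
      fun t => ‖transversal d t‖ ^ n :=
    IsBigO.fun_sum fun s hs => (hder s (Finset.mem_filter.1 hs).2).norm_left
  obtain ⟨C, hC⟩ := hsum.bound
  obtain ⟨ε, hε, hball⟩ := Metric.eventually_nhds_iff_ball.1
    (hC.and (ball_mem_nhds (0 : Fin m → ℂ) hr))
  have hC0 : 0 ≤ |C| := abs_nonneg C
  refine IsBigO.of_bound |C| ?_
  filter_upwards [ball_mem_nhds (0 : Fin m → ℂ) hε] with t ht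
  set γ : ℝ → Fin m → ℂ := fun x => (t - transversal d t) + (x : ℂ) • transversal d t with hγ
  have hγs : ∀ x s, γ x s = if d s = 0 then t s else x * t s := by
    intro x s
    by_cases h : d s = 0 <;> simp [hγ, transversal, h]
  have hγt : ∀ x, transversal d (γ x) = (x : ℂ) • transversal d t := by
    intro x
    ext s
    by_cases h : d s = 0 <;> simp [transversal, hγs, h]
  have hγmem : ∀ x ∈ Set.Icc (0 : ℝ) 1, γ x ∈ ball (0 : Fin m → ℂ) ε := by
    intro x hx
    rw [mem_ball_zero_iff] at ht ⊢
    refine lt_of_le_of_lt ((pi_norm_le_iff_of_nonneg (norm_nonneg t)).2 fun s => ?_) ht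
    rw [hγs]
    split_ifs
    · exact norm_le_pi_norm t s
    · rw [norm_mul, Complex.norm_real, Real.norm_of_nonneg hx.1]
      exact (mul_le_of_le_one_left (norm_nonneg _) hx.2).trans (norm_le_pi_norm t s)
  have hd : ∀ x ∈ Set.Icc (0 : ℝ) 1, HasDerivWithinAt (fun x => f (γ x))
      (fderiv ℂ f (γ x) (transversal d t)) (Set.Icc 0 1) x := by
    intro x hx
    have h1 : HasFDerivAt f (fderiv ℂ f (γ x)) (γ x) :=
      (hf.differentiableAt (isOpen_ball.mem_nhds (hball _ (hγmem x hx)).2)).hasFDerivAt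
    have h2 : HasDerivAt γ (transversal d t) x := by
      exact (((Complex.ofRealCLM.hasDerivAt (x := x)).smul_const
        (transversal d t)).const_add (t - transversal d t)).congr_deriv (by simp)
    exact ((h1.restrictScalars ℝ).comp_hasDerivAt x h2).hasDerivWithinAt
  have hbound : ∀ x ∈ Set.Ico (0 : ℝ) 1,
      ‖fderiv ℂ f (γ x) (transversal d t)‖ ≤ |C| * ‖transversal d t‖ ^ (n + 1) := by
    intro x hx
    have h1 := (hball _ (hγmem x ⟨hx.1, hx.2.le⟩)).1
    rw [Real.norm_of_nonneg (Finset.sum_nonneg fun _ _ => norm_nonneg _), hγt, norm_smul,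
      Complex.norm_real, Real.norm_of_nonneg hx.1, norm_pow,
      Real.norm_of_nonneg (by have := hx.1; positivity)] at h1
    have h2 : (x * ‖transversal d t‖) ^ n ≤ ‖transversal d t‖ ^ n := by
      have := hx.1
      gcongr
      exact mul_le_of_le_one_left (norm_nonneg _) hx.2.le
    rw [fderiv_apply_eq_sum]
    calc ‖∑ s, transversal d t s * fderiv ℂ f (γ x) (Pi.single s 1)‖
        ≤ ∑ s, ‖transversal d t s * fderiv ℂ f (γ x) (Pi.single s 1)‖ := norm_sum_le _ _
      _ ≤ ∑ s, if d s ≠ 0 then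
            ‖transversal d t‖ * ‖fderiv ℂ f (γ x) (Pi.single s 1)‖ else 0 := by
          refine Finset.sum_le_sum fun s _ => ?_
          by_cases h : d s = 0
          · simp [transversal, h]
          · rw [if_pos h, norm_mul]
            gcongr
            exact norm_le_pi_norm _ s
      _ = ‖transversal d t‖ * ∑ s with d s ≠ 0, ‖fderiv ℂ f (γ x) (Pi.single s 1)‖ := by
          rw [← Finset.sum_filter, Finset.mul_sum]
      _ ≤ ‖transversal d t‖ * (|C| * ‖transversal d t‖ ^ n) := by
          gcongr
          have := hx.1
          exact h1.trans (mul_le_mul (le_abs_self C) h2 (by positivity) hC0)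
      _ = _ := by ring
  have key := norm_image_sub_le_of_norm_deriv_le_segment_01' hd hbound
  have e1 : γ 1 = t := by ext s; simp [hγs]
  have e0 : f (γ 0) = 0 :=
    hzero _ (hball _ (hγmem 0 (by simp))).2 fun s hs => by simp [hγs, hs]
  rw [e1, e0, sub_zero] at key
  simpa using key

lemma vanishesToOrder_one {m : ℕ} {d : Fin m → ℤ} {r : ℝ} (hr : 0 < r)
    {f : (Fin m → ℂ) → ℂ} (hf : DifferentiableOn ℂ f (ball 0 r))
    (hzero : ∀ t ∈ ball (0 : Fin m → ℂ) r, (∀ s, d s ≠ 0 → t s = 0) → f t = 0) :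
    VanishesToOrder d 1 f :=
  .of_fderiv hr hf hzero fun _ _ => vanishesToOrder_zero_fderiv hr hf _

/-- A holomorphic function vanishing to infinite order at the centre of a ball is zero. -/
lemma eq_zero_of_forall_vanishesToOrder {m : ℕ} {d : Fin m → ℤ} {r : ℝ}
    {f : (Fin m → ℂ) → ℂ} (hf : DifferentiableOn ℂ f (ball 0 r))
    (hv : ∀ n, VanishesToOrder d n f) {t : Fin m → ℂ} (ht : t ∈ ball (0 : Fin m → ℂ) r) :
    f t = 0 := by
  set U : Set ℂ := (fun z : ℂ => z • t) ⁻¹' ball 0 r with hU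
  have hcont : Continuous fun z : ℂ => z • t := by fun_prop
  have hUopen : IsOpen U := isOpen_ball.preimage hcont
  have hUconv : Convex ℝ U :=
    (convex_ball (0 : Fin m → ℂ) r).is_linear_preimage
      ⟨fun _ _ => add_smul _ _ _, fun _ _ => smul_assoc _ _ _⟩
  have h0 : (0 : ℂ) ∈ U := by
    have : 0 < r := lt_of_le_of_lt (norm_nonneg t) (mem_ball_zero_iff.1 ht)
    simpa [hU] using this
  have h1 : (1 : ℂ) ∈ U := by simpa [hU] using ht
  have hdiff : DifferentiableOn ℂ (fun z : ℂ => f (z • t)) U :=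
    hf.comp (by fun_prop) fun z hz => hz
  have hO : ∀ n : ℕ, (fun z : ℂ => f (z • t)) =O[𝓝 0] fun z : ℂ => z ^ n := by
    intro n
    have ht0 : Tendsto (fun z : ℂ => z • t) (𝓝 0) (𝓝 0) := by
      simpa using hcont.tendsto 0
    refine ((hv n).comp_tendsto ht0).trans (IsBigO.of_bound (‖t‖ ^ n) (.of_forall fun z => ?_))
    simp only [Function.comp, norm_pow, norm_norm]
    rw [← mul_pow]
    gcongr
    refine (norm_transversal_le d _).trans ?_
    rw [norm_smul, mul_comm]
  have han : AnalyticOnNhd ℂ (fun z : ℂ => f (z • t)) U := hdiff.analyticOnNhd hUopen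
  have hev : (fun z : ℂ => f (z • t)) =ᶠ[𝓝 0] 0 := by
    by_contra hne
    obtain ⟨n, φ, hφ, hφ0, hφe⟩ := (han 0 h0).exists_eventuallyEq_pow_smul_nonzero_iff.2 hne
    simp only [sub_zero, smul_eq_mul] at hφe
    have h2 : (fun z => z ^ n * φ z) =O[𝓝[≠] 0] fun z : ℂ => z ^ n * z :=
      (((hO (n + 1)).congr' hφe (.of_forall fun z => pow_succ z n)).mono nhdsWithin_le_nhds)
    have h3 : φ =O[𝓝[≠] 0] fun z : ℂ => z := by
      have hn : ∀ᶠ z : ℂ in 𝓝[≠] 0, z ^ n ≠ 0 :=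
        eventually_mem_nhdsWithin.mono fun z hz => pow_ne_zero n hz
      have h4 := (isBigO_refl (fun z : ℂ => (z ^ n)⁻¹) (𝓝[≠] 0)).mul h2
      refine h4.congr' ?_ ?_ <;>
      · filter_upwards [hn] with z hz
        rw [inv_mul_cancel_left₀ hz]
    have h5 : Tendsto φ (𝓝[≠] 0) (𝓝 0) :=
      h3.trans_tendsto (tendsto_id.mono_left nhdsWithin_le_nhds)
    exact hφ0 (tendsto_nhds_unique (hφ.continuousAt.tendsto.mono_left nhdsWithin_le_nhds) h5)
  have := han.eqOn_zero_of_preconnected_of_eventuallyEq_zero hUconv.isPreconnected h0 hev h1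
  simpa using this

/-- A weighted homogeneous holomorphic function of negative weight, all of whose effective
variables have nonnegative weight, is zero. -/
lemma eq_zero_of_negative_weight {m : ℕ} {d : Fin m → ℤ} {r : ℝ} {f : (Fin m → ℂ) → ℂ}
    (hf : DifferentiableOn ℂ f (ball 0 r))
    (hneg : ∀ s, d s < 0 → ∀ t ∈ ball (0 : Fin m → ℂ) r, fderiv ℂ f t (Pi.single s 1) = 0)
    {q : ℤ} (hq : q < 0)
    (heuler : ∀ t ∈ ball (0 : Fin m → ℂ) r,
      ∑ s, (d s : ℂ) * t s * fderiv ℂ f t (Pi.single s 1) = q * f t)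
    {t : Fin m → ℂ} (ht : t ∈ ball (0 : Fin m → ℂ) r) : f t = 0 := by
  obtain ⟨n, rfl⟩ : ∃ n : ℕ, q = -((n + 1 : ℕ) : ℤ) := ⟨(-q).toNat - 1, by omega⟩
  set γ : ℝ → Fin m → ℂ := fun x s => (x : ℂ) ^ (d s).toNat * t s with hγ
  set γ' : ℝ → Fin m → ℂ := fun x s =>
    ((d s).toNat * (x : ℂ) ^ ((d s).toNat - 1)) * t s with hγ'
  have hγmem : ∀ x ∈ Set.Icc (0 : ℝ) 1, γ x ∈ ball (0 : Fin m → ℂ) r := by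
    intro x hx
    rw [mem_ball_zero_iff] at ht ⊢
    refine lt_of_le_of_lt ((pi_norm_le_iff_of_nonneg (norm_nonneg t)).2 fun s => ?_) ht
    rw [norm_mul, norm_pow, Complex.norm_real, Real.norm_of_nonneg hx.1]
    exact (mul_le_of_le_one_left (norm_nonneg _) (pow_le_one₀ hx.1 hx.2)).trans
      (norm_le_pi_norm t s)
  have hd : ∀ x ∈ Set.Icc (0 : ℝ) 1, HasDerivWithinAt
      (fun x : ℝ => (x : ℂ) ^ (n + 1) * f (γ x)) 0 (Set.Icc 0 1) x := by
    intro x hx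
    have h1 : HasFDerivAt f (fderiv ℂ f (γ x)) (γ x) :=
      (hf.differentiableAt (isOpen_ball.mem_nhds (hγmem x hx))).hasFDerivAt
    have hpow : ∀ k : ℕ, HasDerivAt (fun x : ℝ => (x : ℂ) ^ k) (k * (x : ℂ) ^ (k - 1)) x :=
      fun k => ((Complex.ofRealCLM.hasDerivAt (x := x)).fun_pow k).congr_deriv (by simp)
    have h2 : HasDerivAt γ (γ' x) x :=
      hasDerivAt_pi.2 fun s => (hpow _).mul_const (t s)
    have h3 := (hpow (n + 1)).mul ((h1.restrictScalars ℝ).comp_hasDerivAt x h2)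
    refine (h3.congr_deriv ?_).hasDerivWithinAt
    have h4 : (x : ℂ) * fderiv ℂ f (γ x) (γ' x) = (-((n + 1 : ℕ) : ℤ) : ℤ) * f (γ x) := by
      rw [← heuler _ (hγmem x hx), fderiv_apply_eq_sum, Finset.mul_sum]
      refine Finset.sum_congr rfl fun s _ => ?_
      rcases lt_trichotomy (d s) 0 with h | h | h
      · simp [hneg s h _ (hγmem x hx)]
      · simp [hγ', h]
      · obtain ⟨k, hk⟩ : ∃ k : ℕ, d s = ((k + 1 : ℕ) : ℤ) := ⟨(d s).toNat - 1, by omega⟩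
        simp only [hγ, hγ', hk, Int.toNat_natCast, Nat.add_sub_cancel]
        push_cast
        ring
    simp only [ContinuousLinearMap.coe_restrictScalars', Function.comp, Nat.add_sub_cancel]
    rw [pow_succ, mul_assoc ((x : ℂ) ^ n), h4]
    push_cast
    ring
  have key := norm_image_sub_le_of_norm_deriv_le_segment_01' hd (C := 0) (by simp)
  have e1 : γ 1 = t := by ext s; simp [hγ]
  simpa [e1] using key

lemma VanishesToOrder.apply_zero {m : ℕ} {d : Fin m → ℤ} {f : (Fin m → ℂ) → ℂ}
    (hf : VanishesToOrder d 1 f) : f 0 = 0 := by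
  obtain ⟨C, hC⟩ := hf.bound
  have h0 : transversal d (0 : Fin m → ℂ) = 0 := by ext s; simp [transversal]
  simpa [h0] using hC.self_of_nhds

lemma VanishesToOrder.const_mul {m : ℕ} {d : Fin m → ℤ} {n : ℕ} {f : (Fin m → ℂ) → ℂ}
    (hf : VanishesToOrder d n f) (c : ℂ) : VanishesToOrder d n fun t => c * f t :=
  hf.const_mul_left c

lemma VanishesToOrder.sub {m : ℕ} {d : Fin m → ℤ} {n : ℕ} {f h : (Fin m → ℂ) → ℂ}
    (hf : VanishesToOrder d n f) (hh : VanishesToOrder d n h) :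
    VanishesToOrder d n fun t => f t - h t :=
  IsBigO.sub hf hh

lemma MDiffOn.continuousAt_zero {m : ℕ} {r : ℝ} (hr : 0 < r) {f : (Fin m → ℂ) → Mat m}
    (hf : MDiffOn f (ball 0 r)) : ContinuousAt f 0 :=
  continuousAt_pi.2 fun k => continuousAt_pi.2 fun j =>
    ((hf k j).differentiableAt (ball_mem_nhds _ hr)).continuousAt

section FrobSystem

variable {m : ℕ} {hm : 0 < m} {w : ℤ} {d : Fin m → ℤ} {g : Mat m} {N : Set (Fin m → ℂ)}
  {A : Fin m → (Fin m → ℂ) → Mat m}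

lemma FrobSystem.mono (h : FrobSystem m hm w d g N A) {N' : Set (Fin m → ℂ)} (hN : N' ⊆ N) :
    FrobSystem m hm w d g N' A :=
  fun t ht => h t (hN ht)

lemma FrobSystem.mpderiv_unit (h : FrobSystem m hm w d g N A) (hN : IsOpen N)
    {t : Fin m → ℂ} (ht : t ∈ N) (i : Fin m) :
    mpderiv (A i) t (Pi.single ⟨0, hm⟩ 1) = 0 := by
  rw [(h t ht).2.2.2.1]
  ext k j
  have hc : (fun q => A ⟨0, hm⟩ q k j) =ᶠ[𝓝 t] fun _ => if j = k then 1 else 0 := by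
    filter_upwards [hN.mem_nhds ht] with q hq
    rw [(h q hq).2.2.1, (h q hq).2.1]
  simp [mpderiv, hc.fderiv_eq]

lemma FrobSystem.eq_zero_on_zeroLocus (h : FrobSystem m hm w d g N A) {t : Fin m → ℂ}
    (ht : t ∈ N) (ht0 : ∀ s, d s ≠ 0 → t s = 0) {i j k : Fin m}
    (hne : d k - d i - d j - 1 ≠ 0) : A i t k j = 0 := by
  have h5 := (h t ht).2.2.2.2.1 i j k
  rw [Finset.sum_eq_zero] at h5
  · have : ((d k - d i - d j - 1 : ℤ) : ℂ) ≠ 0 := Int.cast_ne_zero.2 hne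
    exact (mul_eq_zero.1 h5.symm).resolve_left this
  · intro s _
    by_cases hs : d s = 0
    · simp [hs]
    · simp [ht0 s hs]

lemma FrobSystem.eq_zero_of_negative_weight {r : ℝ}
    (h : FrobSystem m hm w d g (ball 0 r) A) (hA : ∀ i, MDiffOn (A i) (ball 0 r))
    (hd : ∀ i : Fin m, i ≠ ⟨0, hm⟩ → 0 ≤ d i) {i j k : Fin m}
    (hneg : d k - d i - d j - 1 < 0) {t : Fin m → ℂ} (ht : t ∈ ball (0 : Fin m → ℂ) r) :
    A i t k j = 0 := by
  refine _root_.eq_zero_of_negative_weight (hA i k j) (fun s hs q hq => ?_) hneg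
    (fun q hq => (h q hq).2.2.2.2.1 i j k) ht
  have hs0 : s = ⟨0, hm⟩ := by
    by_contra hne
    exact absurd (hd s hne) (by omega)
  subst hs0
  exact congr_fun₂ (h.mpderiv_unit isOpen_ball hq i) k j

/-- The symmetric cubic tensor `g(e_i ∘ e_j, e_k)`. -/
def cubicTensor (g : Mat m) (A : Fin m → (Fin m → ℂ) → Mat m) (i j k : Fin m)
    (t : Fin m → ℂ) : ℂ :=
  ∑ s, A i t s j * g s k

lemma FrobSystem.cubicTensor_swap_left (h : FrobSystem m hm w d g N A) {t : Fin m → ℂ}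
    (ht : t ∈ N) (i j k : Fin m) : cubicTensor g A i j k t = cubicTensor g A j i k t :=
  Finset.sum_congr rfl fun s _ => by rw [(h t ht).2.2.1]

lemma FrobSystem.cubicTensor_swap_right (h : FrobSystem m hm w d g N A) {t : Fin m → ℂ}
    (ht : t ∈ N) (i j k : Fin m) : cubicTensor g A i j k t = cubicTensor g A i k j t :=
  (h t ht).2.2.2.2.2 i j k

lemma FrobSystem.cubicTensor_eq_zero {r : ℝ}
    (h : FrobSystem m hm w d g (ball 0 r) A) (hA : ∀ i, MDiffOn (A i) (ball 0 r))
    (hd : ∀ i : Fin m, i ≠ ⟨0, hm⟩ → 0 ≤ d i) (hg : ∀ k l, d k + d l ≠ w - 4 → g k l = 0)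
    {i j k : Fin m} (hijk : w - 5 < d i + d j + d k)
    {t : Fin m → ℂ} (ht : t ∈ ball (0 : Fin m → ℂ) r) : cubicTensor g A i j k t = 0 := by
  refine Finset.sum_eq_zero fun s _ => ?_
  by_cases hs : d s + d k = w - 4
  · rw [h.eq_zero_of_negative_weight hA hd (by omega) ht, zero_mul]
  · rw [hg s k hs, mul_zero]

lemma eq_sum_cubicTensor_mul_inv (hg : IsUnit g) (i j l : Fin m) (t : Fin m → ℂ) :
    A i t l j = ∑ k, g⁻¹ k l * cubicTensor g A i j k t := by
  have h1 : (A i t).transpose * g * g⁻¹ = (A i t).transpose :=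
    Matrix.mul_nonsing_inv_cancel_right _ _ ((Matrix.isUnit_iff_isUnit_det g).1 hg)
  have h2 := congr_fun₂ h1 j l
  rw [Matrix.transpose_apply] at h2
  rw [← h2, Matrix.mul_apply]
  exact Finset.sum_congr rfl fun k _ => by
    rw [mul_comm, Matrix.mul_apply]; rfl

/-- An endomorphism commuting with all multiplications is the multiplication by its value
on the unit. -/
lemma FrobSystem.sum_smul_eq_of_commute (h : FrobSystem m hm w d g N A) {t : Fin m → ℂ}
    (ht : t ∈ N) {M : Mat m} (hM : ∀ j, Commute M (A j t)) (k j : Fin m) :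
    ∑ l, M l ⟨0, hm⟩ * A l t k j = M k j := by
  have h1 := congr_fun₂ (hM j).eq k ⟨0, hm⟩
  simp only [Matrix.mul_apply, (h t ht).2.1, mul_ite, mul_one, mul_zero, Finset.sum_ite_eq,
    Finset.mem_univ, if_true] at h1
  rw [h1]
  exact Finset.sum_congr rfl fun l _ => by rw [(h t ht).2.2.1 l j, mul_comm]

/-- The product of the multiplications by the vector fields listed in `L`. -/
def wordProd (A : Fin m → (Fin m → ℂ) → Mat m) (L : List (Fin m)) (t : Fin m → ℂ) : Mat m :=
  (L.map fun i => A i t).prod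

lemma wordProd_cons (i : Fin m) (L : List (Fin m)) (t : Fin m → ℂ) :
    wordProd A (i :: L) t = A i t * wordProd A L t := by
  simp [wordProd]

lemma FrobSystem.commute_wordProd (h : FrobSystem m hm w d g N A) {t : Fin m → ℂ}
    (ht : t ∈ N) (L : List (Fin m)) (j : Fin m) : Commute (wordProd A L t) (A j t) := by
  refine Commute.list_prod_left _ _ fun x hx => ?_
  obtain ⟨i, _, rfl⟩ := List.mem_map.1 hx
  exact (h t ht).1 i j

lemma continuousAt_wordProd (hA : ∀ i, ContinuousAt (A i) 0) (L : List (Fin m)) :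
    ContinuousAt (wordProd A L) 0 :=
  tendsto_list_prod L fun i _ => hA i

lemma ContinuousAt.matrix_entry {f : (Fin m → ℂ) → Mat m} (hf : ContinuousAt f 0)
    (k j : Fin m) : ContinuousAt (fun t => f t k j) 0 :=
  continuousAt_pi.1 (continuousAt_pi.1 hf k) j

lemma vanishesToOrder_wordProd_sub {A' : Fin m → (Fin m → ℂ) → Mat m} {n : ℕ}
    (hA : ∀ i, ContinuousAt (A i) 0) (hA' : ∀ i, ContinuousAt (A' i) 0)
    (hv : ∀ i, d i = 0 → ∀ k j, VanishesToOrder d n fun t => A i t k j - A' i t k j)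
    (L : List (Fin m)) (hL : ∀ i ∈ L, d i = 0) (k j : Fin m) :
    VanishesToOrder d n fun t => wordProd A L t k j - wordProd A' L t k j := by
  induction L generalizing k with
  | nil => simpa [wordProd] using vanishesToOrder_zero_fun d n
  | cons i L ih =>
    rw [List.forall_mem_cons] at hL
    have h1 : VanishesToOrder d n fun t => ∑ s,
        ((A i t k s - A' i t k s) * wordProd A L t s j +
          A' i t k s * (wordProd A L t s j - wordProd A' L t s j)) := by
      refine .sum fun s _ => .add ?_ ?_
      · simpa using (hv i hL.1 k s).mul
          ((continuousAt_wordProd hA L).matrix_entry s j).vanishesToOrder_zero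
      · simpa using ((hA' i).matrix_entry k s).vanishesToOrder_zero.mul (ih hL.2 s)
    refine h1.congr (.of_forall fun t => ?_)
    simp only [wordProd_cons, Matrix.mul_apply, ← Finset.sum_sub_distrib]
    exact Finset.sum_congr rfl fun s _ => by ring

/-- Along the zero locus of the Euler field, a product of `L.length` multiplications by fields
of weight zero raises the weight by `L.length`. -/
lemma FrobSystem.vanishesToOrder_one_wordProd {r : ℝ} (hr : 0 < r)
    (h : FrobSystem m hm w d g (ball 0 r) A) (hA : ∀ i, MDiffOn (A i) (ball 0 r))
    (L : List (Fin m)) (hL : ∀ i ∈ L, d i = 0) {k j : Fin m} (hkj : d k ≠ d j + L.length) :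
    VanishesToOrder d 1 fun t => wordProd A L t k j := by
  induction L generalizing k with
  | nil =>
    have hne : k ≠ j := by rintro rfl; simp at hkj
    simpa [wordProd, hne] using vanishesToOrder_zero_fun d 1
  | cons i L ih =>
    rw [List.forall_mem_cons] at hL
    simp only [wordProd_cons, Matrix.mul_apply]
    refine .sum fun s _ => ?_
    by_cases hs : d s = d j + L.length
    · have h1 : VanishesToOrder d 1 fun t => A i t k s :=
        vanishesToOrder_one hr (hA i k s) fun t ht ht0 =>
          h.eq_zero_on_zeroLocus ht ht0 (by
            rw [List.length_cons] at hkj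
            push_cast at hkj
            omega)
      simpa using h1.mul ((continuousAt_wordProd (fun i => (hA i).continuousAt_zero hr)
        L).matrix_entry s j).vanishesToOrder_zero
    · simpa using (((hA i).continuousAt_zero hr).matrix_entry k s).vanishesToOrder_zero.mul
        (ih hL.2 hs)

/-- By homogeneity, a generated basis vector is already a combination of the words of the
appropriate length. -/
lemma FrobSystem.single_mem_span_wordProd {r : ℝ} (hr : 0 < r)
    (h : FrobSystem m hm w d g (ball 0 r) A) (hA : ∀ i, MDiffOn (A i) (ball 0 r))
    (hd1 : d ⟨0, hm⟩ = -1) {k : Fin m}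
    (hk : Pi.single k (1 : ℂ) ∈ Submodule.span ℂ
      {v : Fin m → ℂ | ∃ L : List (Fin m), (∀ i ∈ L, d i = 0) ∧
        v = Matrix.mulVec ((L.map fun i => A i 0).prod) (Pi.single ⟨0, hm⟩ 1)}) :
    Pi.single k (1 : ℂ) ∈ Submodule.span ℂ
      {v : Fin m → ℂ | ∃ L : List (Fin m), (∀ i ∈ L, d i = 0) ∧ d k = -1 + L.length ∧
        v = fun l => wordProd A L 0 l ⟨0, hm⟩} := by
  set π : (Fin m → ℂ) →ₗ[ℂ] (Fin m → ℂ) :=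
    LinearMap.pi fun l => if d l = d k then LinearMap.proj l else 0 with hπ
  have hπa : ∀ v l, π v l = if d l = d k then v l else 0 := by
    intro v l
    by_cases hl : d l = d k <;> simp [hπ, hl]
  have hπk : π (Pi.single k 1) = Pi.single k 1 := by
    ext l
    rw [hπa]
    by_cases hl : l = k
    · simp [hl]
    · simp [hl]
  rw [← hπk]
  have hmem := Submodule.mem_map_of_mem (f := π) hk
  rw [Submodule.map_span] at hmem
  refine Submodule.span_le.2 ?_ hmem
  rintro _ ⟨_, ⟨L, hL, rfl⟩, rfl⟩
  have hzero : ∀ l, d l ≠ -1 + L.length → wordProd A L 0 l ⟨0, hm⟩ = 0 := fun l hl =>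
    (h.vanishesToOrder_one_wordProd hr hA L hL (by rwa [hd1])).apply_zero
  have hcol : Matrix.mulVec ((L.map fun i => A i 0).prod) (Pi.single ⟨0, hm⟩ 1) =
      fun l => wordProd A L 0 l ⟨0, hm⟩ := by
    rw [Matrix.mulVec_single_one]; rfl
  rw [hcol]
  by_cases hlen : d k = -1 + L.length
  · refine Submodule.subset_span ⟨L, hL, hlen, ?_⟩
    ext l
    rw [hπa]
    split_ifs with hl
    · rfl
    · exact (hzero l (by omega)).symm
  · have : π (fun l => wordProd A L 0 l ⟨0, hm⟩) = 0 := by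
      ext l
      rw [hπa]
      split_ifs with hl
      · exact hzero l (by omega)
      · rfl
    rw [this]
    exact Submodule.zero_mem _

end FrobSystem

section Comparison

variable {m : ℕ} {hm : 0 < m} {w : ℤ} {d : Fin m → ℤ} {g : Mat m}
  {A₁ A₂ : Fin m → (Fin m → ℂ) → Mat m} {r : ℝ} {n : ℕ}

/-- Agreement of the fields of weight zero along the zero locus of the Euler field improves
agreement of all multiplications to order `n` to agreement of these fields to order `n + 1`. -/
lemma vanishesToOrder_succ_of_weight_zero (hr : 0 < r)
    (hA₁ : ∀ i, MDiffOn (A₁ i) (ball 0 r)) (hA₂ : ∀ i, MDiffOn (A₂ i) (ball 0 r))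
    (h₁ : FrobSystem m hm w d g (ball 0 r) A₁) (h₂ : FrobSystem m hm w d g (ball 0 r) A₂)
    (hagree : ∀ i, d i = 0 → ∀ t ∈ ball (0 : Fin m → ℂ) r, (∀ s, d s ≠ 0 → t s = 0) →
      A₁ i t = A₂ i t)
    (hv : ∀ i k j, VanishesToOrder d n fun t => A₁ i t k j - A₂ i t k j)
    {i : Fin m} (hi : d i = 0) (k j : Fin m) :
    VanishesToOrder d (n + 1) fun t => A₁ i t k j - A₂ i t k j := by
  refine .of_fderiv hr ((hA₁ i k j).sub (hA₂ i k j))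
    (fun t ht ht0 => by simp [hagree i hi t ht ht0]) fun s _ => ?_
  refine ((hv s k j).fderiv_tangential hr ((hA₁ s k j).fun_sub (hA₂ s k j)) hi).congr ?_
  filter_upwards [ball_mem_nhds (0 : Fin m → ℂ) hr] with t ht
  have hdiff : ∀ {A : Fin m → (Fin m → ℂ) → Mat m}, (∀ i, MDiffOn (A i) (ball 0 r)) →
      ∀ i, DifferentiableAt ℂ (fun q => A i q k j) t := fun hA i =>
    (hA i k j).differentiableAt (isOpen_ball.mem_nhds ht)
  have e₁ := congr_fun₂ ((h₁ t ht).2.2.2.1 i s) k j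
  have e₂ := congr_fun₂ ((h₂ t ht).2.2.2.1 i s) k j
  simp only [mpderiv, Matrix.of_apply] at e₁ e₂
  rw [fderiv_fun_sub (hdiff hA₁ s) (hdiff hA₂ s), fderiv_fun_sub (hdiff hA₁ i) (hdiff hA₂ i),
    sub_apply, sub_apply, e₁, e₂]

/-- The span of the words of fixed length acting on the unit lifts to coefficient functions `β`
for which the combination `∑ β_l (A₁ l - A₂ l)` vanishes to the improved order. -/
lemma exists_coefficients_of_mem_span (hr : 0 < r)
    (hA₁ : ∀ i, MDiffOn (A₁ i) (ball 0 r)) (hA₂ : ∀ i, MDiffOn (A₂ i) (ball 0 r))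
    (h₁ : FrobSystem m hm w d g (ball 0 r) A₁) (h₂ : FrobSystem m hm w d g (ball 0 r) A₂)
    (hd1 : d ⟨0, hm⟩ = -1)
    (hv : ∀ i, d i = 0 → ∀ k j, VanishesToOrder d n fun t => A₁ i t k j - A₂ i t k j)
    {k : Fin m} {x : Fin m → ℂ} (hx : x ∈ Submodule.span ℂ
      {v : Fin m → ℂ | ∃ L : List (Fin m), (∀ i ∈ L, d i = 0) ∧ d k = -1 + L.length ∧
        v = fun l => wordProd A₁ L 0 l ⟨0, hm⟩}) :
    ∃ β : Fin m → (Fin m → ℂ) → ℂ, (∀ l, β l 0 = x l) ∧ (∀ l, ContinuousAt (β l) 0) ∧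
      (∀ l, d l ≠ d k → VanishesToOrder d 1 (β l)) ∧
      ∀ a b, VanishesToOrder d n fun t => ∑ l, β l t * (A₁ l t a b - A₂ l t a b) := by
  have hc₁ := fun i => (hA₁ i).continuousAt_zero hr
  have hc₂ := fun i => (hA₂ i).continuousAt_zero hr
  induction hx using Submodule.span_induction with
  | mem x hx =>
    obtain ⟨L, hL, hlen, rfl⟩ := hx
    refine ⟨fun l t => wordProd A₁ L t l ⟨0, hm⟩, fun l => rfl,
      fun l => (continuousAt_wordProd hc₁ L).matrix_entry _ _,
      fun l hl => h₁.vanishesToOrder_one_wordProd hr hA₁ L hL (by rwa [hd1, ← hlen]),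
      fun a b => ?_⟩
    have hsub := vanishesToOrder_wordProd_sub hc₁ hc₂ hv L hL
    have hsum : VanishesToOrder d n fun t => ∑ l,
        (wordProd A₁ L t l ⟨0, hm⟩ - wordProd A₂ L t l ⟨0, hm⟩) * A₂ l t a b :=
      .sum fun l _ => by
        simpa using (hsub l ⟨0, hm⟩).mul ((hc₂ l).matrix_entry a b).vanishesToOrder_zero
    refine ((hsub a b).sub hsum).congr ?_
    filter_upwards [ball_mem_nhds (0 : Fin m → ℂ) hr] with t ht
    rw [← h₁.sum_smul_eq_of_commute ht (h₁.commute_wordProd ht L) a b,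
      ← h₂.sum_smul_eq_of_commute ht (h₂.commute_wordProd ht L) a b,
      ← Finset.sum_sub_distrib, ← Finset.sum_sub_distrib]
    exact Finset.sum_congr rfl fun l _ => by ring
  | zero =>
    exact ⟨fun _ _ => 0, fun _ => rfl, fun _ => continuousAt_const,
      fun _ _ => vanishesToOrder_zero_fun d 1, fun a b => by
        simpa using vanishesToOrder_zero_fun d n⟩
  | add x y _ _ ihx ihy =>
    obtain ⟨β, hβ0, hβc, hβ1, hβ⟩ := ihx
    obtain ⟨β', hβ0', hβc', hβ1', hβ'⟩ := ihy
    refine ⟨fun l t => β l t + β' l t, fun l => by simp [hβ0, hβ0'],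
      fun l => (hβc l).add (hβc' l), fun l hl => (hβ1 l hl).add (hβ1' l hl), fun a b => ?_⟩
    simpa only [add_mul, Finset.sum_add_distrib] using (hβ a b).add (hβ' a b)
  | smul c x _ ih =>
    obtain ⟨β, hβ0, hβc, hβ1, hβ⟩ := ih
    refine ⟨fun l t => c * β l t, fun l => by simp [hβ0],
      fun l => continuousAt_const.mul (hβc l), fun l hl => (hβ1 l hl).const_mul c,
      fun a b => ?_⟩
    simpa only [mul_assoc, Finset.mul_sum] using (hβ a b).const_mul c

/-- The improvement of the order of agreement passes to all generated fields. -/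
lemma vanishesToOrder_succ_of_generated (hr : 0 < r)
    (hA₁ : ∀ i, MDiffOn (A₁ i) (ball 0 r)) (hA₂ : ∀ i, MDiffOn (A₂ i) (ball 0 r))
    (h₁ : FrobSystem m hm w d g (ball 0 r) A₁) (h₂ : FrobSystem m hm w d g (ball 0 r) A₂)
    (hd1 : d ⟨0, hm⟩ = -1)
    (hgen : ∀ k : Fin m, 2 * d k < w - 4 →
      Pi.single k (1 : ℂ) ∈ Submodule.span ℂ
        {v : Fin m → ℂ | ∃ L : List (Fin m), (∀ i ∈ L, d i = 0) ∧
          v = Matrix.mulVec ((L.map fun i => A₁ i 0).prod) (Pi.single ⟨0, hm⟩ 1)})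
    (hv : ∀ i k j, VanishesToOrder d n fun t => A₁ i t k j - A₂ i t k j)
    (hv0 : ∀ i, d i = 0 → ∀ k j, VanishesToOrder d (n + 1) fun t => A₁ i t k j - A₂ i t k j)
    {k : Fin m} (hk : 2 * d k < w - 4) (a b : Fin m) :
    VanishesToOrder d (n + 1) fun t => A₁ k t a b - A₂ k t a b := by
  set F : (Fin m → ℂ) → Fin m → ℂ := fun t k =>
    if 2 * d k < w - 4 then A₁ k t a b - A₂ k t a b else 0 with hF
  have hcorr : ∀ k, ∃ G : (Fin m → ℂ) → ℂ,
      G =o[𝓝 0] F ∧ VanishesToOrder d (n + 1) fun t => G t + F t k := by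
    intro k
    by_cases hk : 2 * d k < w - 4
    swap
    · exact ⟨fun _ => 0, isLittleO_zero _ _, by
        simpa [hF, hk] using vanishesToOrder_zero_fun d (n + 1)⟩
    obtain ⟨β, hβ0, hβc, hβ1, hβ⟩ := exists_coefficients_of_mem_span hr hA₁ hA₂ h₁ h₂ hd1 hv0
      (h₁.single_mem_span_wordProd hr hA₁ hd1 (hgen k hk))
    refine ⟨fun t => ∑ l with d l = d k,
      (β l t - if l = k then 1 else 0) * (A₁ l t a b - A₂ l t a b), ?_, ?_⟩
    · refine IsLittleO.fun_sum fun l hl => ?_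
      have hlk : 2 * d l < w - 4 := by rwa [(Finset.mem_filter.1 hl).2]
      have hFl : (fun t => A₁ l t a b - A₂ l t a b) =O[𝓝 0] F :=
        IsBigO.of_bound 1 (.of_forall fun t => by
          simpa [hF, hlk] using norm_le_pi_norm (F t) l)
      have hβl : (fun t => β l t - if l = k then 1 else 0) =o[𝓝 0] fun _ => (1 : ℝ) := by
        rw [isLittleO_one_iff]
        have := (hβc l).tendsto.sub_const (if l = k then (1 : ℂ) else 0)
        simpa [hβ0, Pi.single_apply] using this
      have hmul := hβl.mul_isBigO hFl.norm_right
      simp only [one_mul] at hmul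
      exact hmul.of_norm_right
    · have hrest : VanishesToOrder d (n + 1) fun t => ∑ l with d l ≠ d k,
          β l t * (A₁ l t a b - A₂ l t a b) :=
        .sum fun l hl => by
          simpa only [add_comm 1 n] using (hβ1 l (Finset.mem_filter.1 hl).2).mul (hv l a b)
      refine ((hβ a b).sub hrest).congr (.of_forall fun t => ?_)
      simp only [hF, if_pos hk, sub_mul, Finset.sum_sub_distrib]
      rw [← Finset.sum_filter_add_sum_filter_not Finset.univ (fun l => d l = d k)]
      simp [Finset.sum_filter]
  choose G hGo hGF using hcorr
  have hGF' : (fun t k => G k t + F t k) =O[𝓝 0] fun t => ‖transversal d t‖ ^ (n + 1) :=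
    isBigO_pi.2 hGF
  have hGo' : (fun t k => G k t) =o[𝓝 0] F := isLittleO_pi.2 hGo
  have hFO : F =O[𝓝 0] fun t => ‖transversal d t‖ ^ (n + 1) :=
    hGo'.right_isBigO_add.trans hGF'
  simpa [VanishesToOrder, hF, hk] using isBigO_pi.1 hFO k

/-- Invariance of the metric propagates the order of agreement from the fields of weight less
than `(w - 4) / 2` to all fields. -/
lemma vanishesToOrder_of_small_weight (hr : 0 < r) (hw : 3 ≤ w)
    (hA₁ : ∀ i, MDiffOn (A₁ i) (ball 0 r)) (hA₂ : ∀ i, MDiffOn (A₂ i) (ball 0 r))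
    (h₁ : FrobSystem m hm w d g (ball 0 r) A₁) (h₂ : FrobSystem m hm w d g (ball 0 r) A₂)
    (hd : ∀ i : Fin m, i ≠ ⟨0, hm⟩ → 0 ≤ d i) (hginv : IsUnit g)
    (hgdeg : ∀ k l, d k + d l ≠ w - 4 → g k l = 0)
    (hv : ∀ k, 2 * d k < w - 4 → ∀ a b, VanishesToOrder d n fun t => A₁ k t a b - A₂ k t a b)
    (i a b : Fin m) : VanishesToOrder d n fun t => A₁ i t a b - A₂ i t a b := by
  have hball := ball_mem_nhds (0 : Fin m → ℂ) hr
  have hsmall : ∀ i j k, 2 * d i < w - 4 → VanishesToOrder d n fun t =>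
      cubicTensor g A₁ i j k t - cubicTensor g A₂ i j k t := by
    intro i j k hi
    have : VanishesToOrder d n fun t => ∑ s, g s k * (A₁ i t s j - A₂ i t s j) :=
      .sum fun s _ => (hv i hi s j).const_mul _
    refine this.congr (.of_forall fun t => ?_)
    simp only [cubicTensor, ← Finset.sum_sub_distrib]
    exact Finset.sum_congr rfl fun s _ => by ring
  have hcubic : ∀ i j k, VanishesToOrder d n fun t =>
      cubicTensor g A₁ i j k t - cubicTensor g A₂ i j k t := by
    intro i j k
    by_cases hijk : w - 5 < d i + d j + d k
    · refine (vanishesToOrder_zero_fun d n).congr ?_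
      filter_upwards [hball] with t ht
      rw [h₁.cubicTensor_eq_zero hA₁ hd hgdeg hijk ht,
        h₂.cubicTensor_eq_zero hA₂ hd hgdeg hijk ht, sub_zero]
    by_cases hi : 2 * d i < w - 4
    · exact hsmall i j k hi
    by_cases hj : 2 * d j < w - 4
    · refine (hsmall j i k hj).congr ?_
      filter_upwards [hball] with t ht
      rw [h₁.cubicTensor_swap_left ht, h₂.cubicTensor_swap_left ht]
    · refine (hsmall k i j (by omega)).congr ?_
      filter_upwards [hball] with t ht
      rw [h₁.cubicTensor_swap_left ht, h₂.cubicTensor_swap_left ht,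
        h₁.cubicTensor_swap_right ht, h₂.cubicTensor_swap_right ht]
  have : VanishesToOrder d n fun t => ∑ k,
      g⁻¹ k a * (cubicTensor g A₁ i b k t - cubicTensor g A₂ i b k t) :=
    .sum fun k _ => (hcubic i b k).const_mul _
  refine this.congr (.of_forall fun t => ?_)
  simp only [mul_sub, Finset.sum_sub_distrib, ← eq_sum_cubicTensor_mul_inv hginv]

end Comparison

theorem stmt_13
    (m : ℕ) (hm : 0 < m) (w : ℤ) (hw : 3 ≤ w)
    (d : Fin m → ℤ) (hd1 : d (⟨0, hm⟩ : Fin m) = -1)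
    (hdrange : ∀ i : Fin m, i ≠ (⟨0, hm⟩ : Fin m) → 0 ≤ d i ∧ d i ≤ w - 3)
    (g : Mat m) (hgsym : g.IsSymm) (hginv : IsUnit g)
    (hgdeg : ∀ k l, d k + d l ≠ w - 4 → g k l = 0)
    (N₁ N₂ : Set (Fin m → ℂ)) (hN₁open : IsOpen N₁) (hN₂open : IsOpen N₂)
    (hN₁conn : IsConnected N₁) (hN₂conn : IsConnected N₂)
    (h0₁ : (0 : Fin m → ℂ) ∈ N₁) (h0₂ : (0 : Fin m → ℂ) ∈ N₂)
    (A₁ A₂ : Fin m → (Fin m → ℂ) → Mat m)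
    (hA₁d : ∀ i, MDiffOn (A₁ i) N₁) (hA₂d : ∀ i, MDiffOn (A₂ i) N₂)
    (hsys₁ : FrobSystem m hm w d g N₁ A₁)
    (hsys₂ : FrobSystem m hm w d g N₂ A₂)
    -- (II)' weakened H²-generation condition: in the algebra (ℂ^m, ∘) with unit e_1
    -- and e_i ∘ e_j = Σ_k a_{ij}^{k,(1)}(0) e_k, the subalgebra generated by
    -- { e_i : d_i = 0 } contains every e_k with d_k < (w-4)/2
    (hgen : ∀ k : Fin m, 2 * d k < w - 4 →
      Pi.single k (1 : ℂ) ∈ Submodule.span ℂ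
        {v : Fin m → ℂ | ∃ L : List (Fin m), (∀ i ∈ L, d i = 0) ∧
          v = Matrix.mulVec ((L.map fun i => A₁ i 0).prod)
            (Pi.single (⟨0, hm⟩ : Fin m) 1)})
    -- agreement on the zero locus of the Euler field, for the fields with d_i = 0
    (hagree : ∀ i : Fin m, d i = 0 →
      ∀ t ∈ N₁ ∩ N₂, (∀ s : Fin m, d s ≠ 0 → t s = 0) → A₁ i t = A₂ i t) :
    ∃ N : Set (Fin m → ℂ), IsOpen N ∧ (0 : Fin m → ℂ) ∈ N ∧ N ⊆ N₁ ∩ N₂ ∧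
      ∀ i : Fin m, ∀ t ∈ N, A₁ i t = A₂ i t := by
  obtain ⟨r, hr, hball⟩ := Metric.isOpen_iff.1 (hN₁open.inter hN₂open) 0 ⟨h0₁, h0₂⟩
  have hd : ∀ i : Fin m, i ≠ ⟨0, hm⟩ → 0 ≤ d i := fun i hi => (hdrange i hi).1
  have h₁ := hsys₁.mono (hball.trans Set.inter_subset_left)
  have h₂ := hsys₂.mono (hball.trans Set.inter_subset_right)
  have hA₁ : ∀ i, MDiffOn (A₁ i) (ball 0 r) := fun i k j =>
    (hA₁d i k j).mono (hball.trans Set.inter_subset_left)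
  have hA₂ : ∀ i, MDiffOn (A₂ i) (ball 0 r) := fun i k j =>
    (hA₂d i k j).mono (hball.trans Set.inter_subset_right)
  have hv : ∀ n i k j, VanishesToOrder d n fun t => A₁ i t k j - A₂ i t k j := by
    intro n
    induction n with
    | zero =>
      exact fun i k j => ContinuousAt.vanishesToOrder_zero
        ((((hA₁ i).continuousAt_zero hr).matrix_entry k j).sub
          (((hA₂ i).continuousAt_zero hr).matrix_entry k j))
    | succ n ih =>
      have hv0 := fun (i : Fin m) (hi : d i = 0) => vanishesToOrder_succ_of_weight_zero hr
        hA₁ hA₂ h₁ h₂ (fun i hi t ht => hagree i hi t (hball ht)) ih hi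
      exact vanishesToOrder_of_small_weight hr hw hA₁ hA₂ h₁ h₂ hd hginv hgdeg fun k hk =>
        vanishesToOrder_succ_of_generated hr hA₁ hA₂ h₁ h₂ hd1 hgen ih hv0 hk
  refine ⟨ball 0 r, isOpen_ball, mem_ball_self hr, hball, fun i t ht => ?_⟩
  ext k j
  exact sub_eq_zero.1
    (eq_zero_of_forall_vanishesToOrder ((hA₁ i k j).sub (hA₂ i k j)) (hv · i k j) ht)
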